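/- Let M be a matrix in the subgroup of invertible 2×2 matrices over ℤ[t,t⁻¹] generated by A and B (so M is the reduced Burau matrix of some 3-braid β), and suppose that the integer matrix obtained by evaluating M entrywise at t = −1 has trace of absolute value strictly less than 2 (i.e., β is periodic). Then there exists an integer k such that M¹² = t^{6k} · I₂; in particular the trace of M¹² equals 2 t^{6k}. -/

import Mathlib

open LaurentPolynomial Matrix

/-- The reduced Burau matrix of σ₁ ∈ B₃. -/
noncomputable def Amat : Matrix (Fin 2) (Fin 2) (LaurentPolynomial ℤ) := !![-T 1, 1; 0, 1]

/-- The reduced Burau matrix of σ₂ ∈ B₃. -/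
noncomputable def Bmat : Matrix (Fin 2) (Fin 2) (LaurentPolynomial ℤ) := !![1, 0; T 1, -T 1]

/-- The reduced Burau matrix of σ₁, as an invertible matrix. -/
noncomputable def Au : (Matrix (Fin 2) (Fin 2) (LaurentPolynomial ℤ))ˣ where
  val := Amat
  inv := !![-T (-1), T (-1); 0, 1]
  val_inv := by
    simp only [Amat, Matrix.mul_fin_two, Matrix.one_fin_two, neg_mul_neg, neg_mul, mul_neg,
      ← T_add]
    norm_num
  inv_val := by
    simp only [Amat, Matrix.mul_fin_two, Matrix.one_fin_two, neg_mul_neg, neg_mul, mul_neg,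
      ← T_add]
    norm_num

/-- The reduced Burau matrix of σ₂, as an invertible matrix. -/
noncomputable def Bu : (Matrix (Fin 2) (Fin 2) (LaurentPolynomial ℤ))ˣ where
  val := Bmat
  inv := !![1, 0; 1, -T (-1)]
  val_inv := by
    simp only [Bmat, Matrix.mul_fin_two, Matrix.one_fin_two, neg_mul_neg, neg_mul, mul_neg,
      ← T_add]
    norm_num
  inv_val := by
    simp only [Bmat, Matrix.mul_fin_two, Matrix.one_fin_two, neg_mul_neg, neg_mul, mul_neg,
      ← T_add]
    norm_num

section TriangleWords

variable {G : Type*} [Group G] {X Y z a b : G}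

/-- A conjugation-invariant property, insensitive to the central element `z`, which holds at `X`,
`Y`, `Y⁻¹` and at all words in `a`, `b`, holds at `X * p`, `Y * p` and `Y⁻¹ * p` for every
word `p` in `a`, `b`. -/
theorem conj_invariant_mul_word (hc : ∀ g, z * g = g * z) (hXX : X * X = z) (hYa : Y * a = X)
    (hYb : Y * b = a) (hYX : Y * X = z * b) {Q : G → Prop}
    (hconj : ∀ g h, Q (g * h) → Q (h * g)) (hz : ∀ g, Q (z * g) ↔ Q g)
    (hQX : Q X) (hQY : Q Y) (hQY' : Q Y⁻¹)
    (hpos : ∀ l : List G, (∀ u ∈ l, u = a ∨ u = b) → Q l.prod) (n : ℕ) :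
    ∀ l : List G, l.length = n → (∀ u ∈ l, u = a ∨ u = b) →
      Q (X * l.prod) ∧ Q (Y * l.prod) ∧ Q (Y⁻¹ * l.prod) := by
  induction n with
  | zero =>
    intro l hl _
    obtain rfl := List.length_eq_zero_iff.mp hl
    simpa using ⟨hQX, hQY, hQY'⟩
  | succ n ih =>
    intro l hl hmem
    refine ⟨?_, ?_⟩
    · obtain rfl | ⟨l', u, rfl⟩ := l.eq_nil_or_concat'
      · simp at hl
      have hl' : l'.length = n := by simpa using hl
      have hmem' : ∀ u ∈ l', u = a ∨ u = b := fun v hv => hmem v (by simp [hv])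
      obtain ⟨-, h2, h3⟩ := ih l' hl' hmem'
      rw [List.prod_append, List.prod_singleton]
      rcases hmem u (by simp) with rfl | rfl
      · have h : Q (l'.prod * Y⁻¹) := hconj _ _ h3
        rw [← hz, ← hXX, mul_assoc] at h
        have h' := hconj _ _ h
        rwa [mul_assoc, mul_assoc, show Y⁻¹ * X = u by rw [← hYa, inv_mul_cancel_left]] at h'
      · have h : Q (l'.prod * Y) := hconj _ _ h2
        rw [← hz, ← hXX, mul_assoc] at h
        have h' := hconj _ _ h
        rwa [mul_assoc, mul_assoc, hYX, ← mul_assoc l'.prod, ← hc, mul_assoc, ← mul_assoc X, ← hc,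
          mul_assoc, hz] at h'
    · obtain _ | ⟨u, l'⟩ := l
      · simp at hl
      have hl' : l'.length = n := by simpa using hl
      have hmem' : ∀ u ∈ l', u = a ∨ u = b := fun v hv => hmem v (by simp [hv])
      obtain ⟨h1, -, -⟩ := ih l' hl' hmem'
      rw [List.prod_cons, ← mul_assoc, ← mul_assoc]
      rcases hmem u (by simp) with rfl | rfl
      · refine ⟨by rwa [hYa], ?_⟩
        rw [← hYb, inv_mul_cancel_left]
        simpa using hpos (b :: l') (by simpa using hmem')
      · constructor
        · rw [hYb]
          simpa using hpos (a :: l') (by simpa using hmem')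
        · rw [← hz, ← mul_assoc, ← mul_assoc, hc, mul_assoc Y⁻¹, ← hYX, inv_mul_cancel_left]
          exact h1

/-- Normal form, up to powers of the central element `z`, of the elements of the subgroup
generated by `X` and `Y`. -/
theorem exists_word_of_mem_closure (hc : ∀ g, z * g = g * z) (hXX : X * X = z) (hYa : Y * a = X)
    (hYb : Y * b = a) (hYX : Y * X = z * b) {g : G} (hg : g ∈ Subgroup.closure {X, Y}) :
    ∃ (j : ℤ) (s d : G) (l : List G), (s = 1 ∨ s = X) ∧ (d = 1 ∨ d = Y ∨ d = Y⁻¹) ∧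
      (∀ u ∈ l, u = a ∨ u = b) ∧ g = z ^ j * (s * (l.prod * d)) := by
  have hcj : ∀ (j : ℤ) (g h : G), g * (z ^ j * h) = z ^ j * (g * h) := fun j g h =>
    ((show Commute g z from (hc g).symm).zpow_right j).left_comm h
  have hYY : Y * Y = z * Y⁻¹ := by
    rw [eq_mul_inv_iff_mul_eq]
    have : Y * Y * Y * b = z * b := by simp only [mul_assoc, hYb, hYa, hYX]
    exact mul_right_cancel this
  set S : G → Prop := fun g => ∃ (j : ℤ) (s d : G) (l : List G), (s = 1 ∨ s = X) ∧
    (d = 1 ∨ d = Y ∨ d = Y⁻¹) ∧ (∀ u ∈ l, u = a ∨ u = b) ∧ g = z ^ j * (s * (l.prod * d))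
  have hSz : ∀ (i : ℤ) (g : G), S g → S (z ^ i * g) := by
    rintro i _ ⟨j, s, d, l, hs, hd, hl, rfl⟩
    exact ⟨i + j, s, d, l, hs, hd, hl, by rw [_root_.zpow_add, mul_assoc]⟩
  have hSX : ∀ g, S g → S (X * g) := by
    rintro _ ⟨j, s, d, l, hs, hd, hl, rfl⟩
    rw [hcj]
    apply hSz
    rcases hs with rfl | rfl
    · exact ⟨0, X, d, l, .inr rfl, hd, hl, by simp⟩
    · exact ⟨1, 1, d, l, .inl rfl, hd, hl, by rw [← mul_assoc, hXX]; simp⟩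
  have hSY : ∀ g, S g → S (Y * g) := by
    rintro _ ⟨j, s, d, l, hs, hd, hl, rfl⟩
    rw [hcj]
    apply hSz
    rcases hs with rfl | rfl
    · obtain _ | ⟨u, l⟩ := l
      · rcases hd with rfl | rfl | rfl
        · exact ⟨0, 1, Y, [], by simp, by simp, by simp, by simp⟩
        · exact ⟨1, 1, d⁻¹, [], by simp, by simp, by simp, by simp [hYY]⟩
        · exact ⟨0, 1, 1, [], by simp, by simp, by simp, by simp⟩
      · have hl' : ∀ u ∈ l, u = a ∨ u = b := fun v hv => hl v (by simp [hv])
        rcases hl u (by simp) with rfl | rfl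
        · exact ⟨0, X, d, l, .inr rfl, hd, hl', by simp [← hYa, mul_assoc]⟩
        · exact ⟨0, 1, d, a :: l, .inl rfl, hd, by simpa using hl', by simp [← hYb, mul_assoc]⟩
    · exact ⟨1, 1, d, b :: l, .inl rfl, hd, by simpa using hl, by
        rw [← mul_assoc, hYX]; simp [mul_assoc]⟩
  change S g
  induction hg using Subgroup.closure_induction_left with
  | one => exact ⟨0, 1, 1, [], by simp, by simp, by simp, by simp⟩
  | mul_left x hx y _ ih =>
    rcases hx with rfl | rfl
    · exact hSX _ ih
    · exact hSY _ ih
  | inv_mul_cancel x hx y _ ih =>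
    rcases hx with rfl | rfl
    · convert hSz (-1) _ (hSX _ ih) using 1
      rw [← hXX]; simp
    · convert hSz (-1) _ (hSY _ (hSY _ ih)) using 1
      rw [← mul_assoc x, hYY]; simp [mul_assoc]

/-- A conjugation-invariant property, insensitive to the central element `z`, which holds at `X`,
`Y`, `Y⁻¹` and at all words in `a`, `b`, holds on the subgroup generated by `X` and `Y`. -/
theorem conj_invariant_of_mem_closure (hc : ∀ g, z * g = g * z) (hXX : X * X = z)
    (hYa : Y * a = X) (hYb : Y * b = a) (hYX : Y * X = z * b) {Q : G → Prop}
    (hconj : ∀ g h, Q (g * h) → Q (h * g)) (hz : ∀ g, Q (z * g) ↔ Q g)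
    (hQX : Q X) (hQY : Q Y) (hQY' : Q Y⁻¹)
    (hpos : ∀ l : List G, (∀ u ∈ l, u = a ∨ u = b) → Q l.prod) {g : G}
    (hg : g ∈ Subgroup.closure {X, Y}) : Q g := by
  obtain ⟨j, s, d, l, hs, hd, hl, rfl⟩ := exists_word_of_mem_closure hc hXX hYa hYb hYX hg
  have hzj : ∀ (j : ℤ) (g : G), Q g → Q (z ^ j * g) := by
    intro j g h
    induction j with
    | zero => simpa
    | succ i ih => rwa [add_comm, _root_.zpow_add, zpow_one, mul_assoc, hz]
    | pred i ih => rwa [← hz, ← mul_assoc, ← _root_.zpow_one_add, add_sub_cancel]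
  obtain ⟨h1, h2, h3⟩ :=
    conj_invariant_mul_word hc hXX hYa hYb hYX hconj hz hQX hQY hQY' hpos _ l rfl hl
  apply hzj
  rw [← mul_assoc]
  apply hconj
  rcases hs with rfl | rfl <;> rcases hd with rfl | rfl | rfl
  · simpa using hpos l hl
  · simpa using h2
  · simpa using h3
  · simpa using h1
  · rw [← mul_assoc, hYX, mul_assoc, hz]
    simpa using hpos (b :: l) (by simpa using hl)
  · rw [← hYa, ← mul_assoc, inv_mul_cancel_left]
    simpa using hpos (a :: l) (by simpa using hl)

end TriangleWords

/-- The scalar matrix `t³`, the reduced Burau matrix of the full twist. -/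
noncomputable def fullTwist : (Matrix (Fin 2) (Fin 2) (LaurentPolynomial ℤ))ˣ where
  val := (T 3 : LaurentPolynomial ℤ) • 1
  inv := (T (-3) : LaurentPolynomial ℤ) • 1
  val_inv := by rw [smul_mul_smul_comm, one_mul, ← T_add, add_neg_cancel, T_zero, one_smul]
  inv_val := by rw [smul_mul_smul_comm, one_mul, ← T_add, neg_add_cancel, T_zero, one_smul]

theorem fullTwist_mul_comm (g : (Matrix (Fin 2) (Fin 2) (LaurentPolynomial ℤ))ˣ) :
    fullTwist * g = g * fullTwist := by
  ext1
  simp [fullTwist]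

theorem halfTwist_sq : Au * Bu * Au * (Au * Bu * Au) = fullTwist := by
  ext1
  simp only [Au, Bu, Amat, Bmat, fullTwist, Units.val_mul, Matrix.mul_fin_two,
    Matrix.one_fin_two, Matrix.smul_of, Matrix.smul_cons, Matrix.smul_empty, smul_eq_mul,
    show (T 3 : LaurentPolynomial ℤ) = T 1 * T 1 * T 1 by rw [← T_add, ← T_add]; norm_num]
  congr 1
  ext i j
  fin_cases i <;> fin_cases j <;>
    simp only [Fin.zero_eta, Fin.mk_one, Matrix.cons_val', Matrix.cons_val_zero,
      Matrix.cons_val_one, Matrix.cons_val_fin_one] <;>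
    ring

theorem braid_relation : Au * Bu * Au = Bu * Au * Bu := by
  ext1
  simp only [Au, Bu, Amat, Bmat, Units.val_mul, Matrix.mul_fin_two]
  congr 1
  ext i j
  fin_cases i <;> fin_cases j <;> simp

theorem mul_halfTwist : Au * Bu * (Au * Bu * Au) = fullTwist * Bu⁻¹ := by
  rw [eq_mul_inv_iff_mul_eq, ← halfTwist_sq]
  conv_rhs => arg 2; rw [braid_relation]
  simp only [mul_assoc]

theorem cube_eq_fullTwist : (Au * Bu) ^ 3 = fullTwist := by
  have h := mul_halfTwist
  rw [eq_mul_inv_iff_mul_eq] at h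
  rw [← h]
  simp only [pow_succ, pow_zero, one_mul, mul_assoc]

theorem closure_pair_le_closure_halfTwist {G : Type*} [Group G] (x y : G) :
    Subgroup.closure {x, y} ≤ Subgroup.closure {x * y * x, x * y} := by
  have hX : x * y * x ∈ Subgroup.closure {x * y * x, x * y} :=
    Subgroup.subset_closure (by simp)
  have hY : x * y ∈ Subgroup.closure {x * y * x, x * y} :=
    Subgroup.subset_closure (by simp)
  have hx : x ∈ Subgroup.closure {x * y * x, x * y} := (Subgroup.mul_mem_cancel_left _ hY).mp hX
  have hy : y ∈ Subgroup.closure {x * y * x, x * y} := (Subgroup.mul_mem_cancel_left _ hx).mp hY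
  rw [Subgroup.closure_le]
  rintro _ (rfl | rfl)
  exacts [hx, hy]

theorem coe_fullTwist_zpow (j : ℤ) :
    ((fullTwist ^ j : (Matrix (Fin 2) (Fin 2) (LaurentPolynomial ℤ))ˣ) :
      Matrix (Fin 2) (Fin 2) (LaurentPolynomial ℤ)) = (T (3 * j) : LaurentPolynomial ℤ) • 1 := by
  have key : ∀ n : ℕ, ((T 3 : LaurentPolynomial ℤ) •
      (1 : Matrix (Fin 2) (Fin 2) (LaurentPolynomial ℤ))) ^ n =
      (T (3 * n) : LaurentPolynomial ℤ) • 1 ∧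
      ((T (-3) : LaurentPolynomial ℤ) •
      (1 : Matrix (Fin 2) (Fin 2) (LaurentPolynomial ℤ))) ^ n =
      (T (-(3 * n)) : LaurentPolynomial ℤ) • 1 := by
    intro n
    simp only [smul_pow, one_pow, T_pow]
    constructor <;> congr 2 <;> ring
  obtain ⟨n, rfl | rfl⟩ := j.eq_nat_or_neg
  · simpa [fullTwist] using (key n).1
  · rw [_root_.zpow_neg, ← _root_.inv_zpow]
    simpa [fullTwist] using (key n).2

/-- A nonnegative integer matrix of size two and determinant one has trace at least two. -/
theorem two_le_trace_of_nonneg_of_det_eq_one (N : Matrix (Fin 2) (Fin 2) ℤ)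
    (h : ∀ i j, 0 ≤ N i j) (hdet : N.det = 1) : 2 ≤ N.trace := by
  rw [Matrix.det_fin_two] at hdet
  rw [Matrix.trace_fin_two]
  have h1 := mul_nonneg (h 0 1) (h 1 0)
  have h0 := h 0 0
  have h3 := h 1 1
  have : N 0 0 ≠ 0 := by rintro e; rw [e] at hdet; linarith
  have : N 1 1 ≠ 0 := by rintro e; rw [e] at hdet; linarith
  lia

theorem map_list_prod_nonneg_and_det (ev : LaurentPolynomial ℤ →+* ℤ) (hev : ev (T 1) = -1)
    (l : List (Matrix (Fin 2) (Fin 2) (LaurentPolynomial ℤ))ˣ)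
    (hl : ∀ u ∈ l, u = Au ∨ u = Bu⁻¹) :
    (∀ i j, 0 ≤ (l.prod : Matrix (Fin 2) (Fin 2) (LaurentPolynomial ℤ)).map ev i j) ∧
      ((l.prod : Matrix (Fin 2) (Fin 2) (LaurentPolynomial ℤ)).map ev).det = 1 := by
  have hev' : ev (T (-1)) = -1 := by
    have h : ev (T 1 * T (-1)) = 1 := by rw [← T_add]; simp
    rw [map_mul, hev] at h
    linarith
  induction l with
  | nil =>
    rw [List.prod_nil, Units.val_one, Matrix.map_one _ (map_zero ev) (map_one ev)]
    exact ⟨fun i j => by fin_cases i <;> fin_cases j <;> simp, Matrix.det_one⟩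
  | cons u l ih =>
    obtain ⟨ih1, ih2⟩ := ih fun v hv => hl v (by simp [hv])
    have hu : (∀ i j, 0 ≤ (u : Matrix (Fin 2) (Fin 2) (LaurentPolynomial ℤ)).map ev i j) ∧
        ((u : Matrix (Fin 2) (Fin 2) (LaurentPolynomial ℤ)).map ev).det = 1 := by
      rcases hl u (by simp) with rfl | rfl
      · constructor
        · intro i j
          fin_cases i <;> fin_cases j <;> simp [Au, Amat, hev]
        · simp [Au, Amat, hev, Matrix.det_fin_two]
      · constructor
        · intro i j
          fin_cases i <;> fin_cases j <;> simp [Bu, Units.inv_mk, hev']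
        · simp [Bu, Units.inv_mk, hev', Matrix.det_fin_two]
    rw [List.prod_cons, Units.val_mul, Matrix.map_mul]
    refine ⟨fun i j => ?_, by rw [Matrix.det_mul, hu.2, ih2, one_mul]⟩
    rw [Matrix.mul_apply]
    exact Finset.sum_nonneg fun k _ => mul_nonneg (hu.1 i k) (ih1 k j)

/-- If a matrix M in the subgroup generated by the reduced Burau matrices A, B of
σ₁, σ₂ ∈ B₃ (i.e. the reduced Burau matrix of some 3-braid β) evaluates at t = −1 to
an integer matrix of trace of absolute value less than 2 (i.e. β is periodic), then
M¹² = t^{6k}·I₂ for some integer k; in particular tr(M¹²) = 2t^{6k}. -/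
theorem periodic_burau_pow_twelve (M : (Matrix (Fin 2) (Fin 2) (LaurentPolynomial ℤ))ˣ)
    (hM : M ∈ Subgroup.closure {Au, Bu})
    (ev : LaurentPolynomial ℤ →+* ℤ) (hev : ev (T 1) = -1)
    (htr : |Matrix.trace ((M : Matrix (Fin 2) (Fin 2) (LaurentPolynomial ℤ)).map ev)| < 2) :
    ∃ k : ℤ,
      ((M ^ 12 : (Matrix (Fin 2) (Fin 2) (LaurentPolynomial ℤ))ˣ) :
          Matrix (Fin 2) (Fin 2) (LaurentPolynomial ℤ)) =
        (T (6 * k) : LaurentPolynomial ℤ) •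
          (1 : Matrix (Fin 2) (Fin 2) (LaurentPolynomial ℤ)) ∧
      Matrix.trace
          ((M ^ 12 : (Matrix (Fin 2) (Fin 2) (LaurentPolynomial ℤ))ˣ) :
            Matrix (Fin 2) (Fin 2) (LaurentPolynomial ℤ)) =
        2 * T (6 * k) := by
  suffices h : ∃ k : ℤ, M ^ 12 = fullTwist ^ (2 * k) by
    obtain ⟨k, hk⟩ := h
    have h12 := coe_fullTwist_zpow (2 * k)
    rw [← hk, show 3 * (2 * k) = 6 * k by ring] at h12
    exact ⟨k, h12, by rw [h12, Matrix.trace_smul, Matrix.trace_one, smul_eq_mul, mul_comm]; rfl⟩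
  revert htr
  refine conj_invariant_of_mem_closure (Q := fun M =>
      |Matrix.trace ((M : Matrix (Fin 2) (Fin 2) (LaurentPolynomial ℤ)).map ev)| < 2 →
        ∃ k : ℤ, M ^ 12 = fullTwist ^ (2 * k))
    fullTwist_mul_comm halfTwist_sq rfl (mul_inv_cancel_right Au Bu) mul_halfTwist
    ?_ ?_ ?_ ?_ ?_ ?_ (closure_pair_le_closure_halfTwist Au Bu hM)
  · intro g h hQ htr
    rw [Units.val_mul, Matrix.map_mul, Matrix.trace_mul_comm, ← Matrix.map_mul,
      ← Units.val_mul] at htr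
    obtain ⟨k, hk⟩ := hQ htr
    refine ⟨k, ?_⟩
    have hconj : h * g = h * (g * h) * h⁻¹ := by group
    have hcomm : Commute (fullTwist ^ (2 * k)) h :=
      (show Commute fullTwist h from fullTwist_mul_comm h).zpow_left _
    rw [hconj, conj_pow, hk, ← hcomm.eq, mul_inv_cancel_right]
  · intro g
    have htr : Matrix.trace (((fullTwist * g : (Matrix (Fin 2) (Fin 2) (LaurentPolynomial ℤ))ˣ) :
        Matrix (Fin 2) (Fin 2) (LaurentPolynomial ℤ)).map ev) =
        -Matrix.trace ((g : Matrix (Fin 2) (Fin 2) (LaurentPolynomial ℤ)).map ev) := by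
      have h3 : ev (T 3) = -1 := by
        rw [show (3 : ℤ) = (3 : ℕ) * 1 by norm_num, ← T_pow, map_pow, hev]; norm_num
      simp [fullTwist, Matrix.trace_fin_two, h3]
      ring
    have hpow : (fullTwist * g) ^ 12 = fullTwist ^ (12 : ℤ) * g ^ 12 := by
      rw [(show Commute fullTwist g from fullTwist_mul_comm g).mul_pow]
      norm_cast
    simp only [htr, abs_neg, hpow]
    refine forall_congr' fun _ => ⟨?_, ?_⟩
    · rintro ⟨k, hk⟩
      refine ⟨-6 + k, ?_⟩
      rw [mul_add, _root_.zpow_add, ← hk, ← mul_assoc, ← _root_.zpow_add]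
      simp
    · rintro ⟨k, hk⟩
      exact ⟨6 + k, by rw [hk, ← _root_.zpow_add]; congr 1; ring⟩
  · intro _
    refine ⟨3, ?_⟩
    rw [show 12 = 2 * 6 by norm_num, pow_mul, sq, halfTwist_sq]
    norm_cast
  · intro _
    refine ⟨2, ?_⟩
    rw [show 12 = 3 * 4 by norm_num, pow_mul, cube_eq_fullTwist]
    norm_cast
  · intro _
    refine ⟨-2, ?_⟩
    rw [show 12 = 3 * 4 by norm_num, pow_mul, inv_pow, cube_eq_fullTwist, inv_pow, mul_neg,
      _root_.zpow_neg]
    norm_cast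
  · intro l hl htr
    obtain ⟨h1, h2⟩ := map_list_prod_nonneg_and_det ev hev l hl
    have := two_le_trace_of_nonneg_of_det_eq_one _ h1 h2
    exact absurd htr (not_lt.mpr (this.trans (le_abs_self _)))
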